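/- arXiv:2310.09724 — 5 statements merged into one kernel-verified Lean document; each statement's English description precedes it below -/
import Mathlib

section
/- For every ε > 0 one has F(b) ≤ (1/p)[(p+2) Σ_{i,α,μ} (b^μ_{iα})² + nε Σ_{i,j,μ} (b^μ_{ij})² + (n + p/ε) Σ_{α,β,μ} (b^μ_{αβ})²]. -/
/-- The squared trace of `f` over `s` is at most `#s` times its squared Hilbert-Schmidt norm. -/
theorem sq_sum_diag_le {ι : Type*} (s : Finset ι) (f : ι → ι → ℝ) :
    (∑ i ∈ s, f i i) ^ 2 ≤ (s.card : ℝ) * ∑ i ∈ s, ∑ j ∈ s, f i j ^ 2 := by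
  refine (sq_sum_le_card_mul_sum_sq (s := s) (f := fun i => f i i)).trans ?_
  refine mul_le_mul_of_nonneg_left (Finset.sum_le_sum fun i hi => ?_) (Nat.cast_nonneg _)
  exact Finset.single_le_sum (f := fun j => f i j ^ 2) (fun j _ => sq_nonneg _) hi

/-- The sum of the principal `2 × 2` minors, up to symmetry, in terms of trace and norm. -/
theorem sum_erase_diag_mul_diag_sub_sq {ι : Type*} [DecidableEq ι] (s : Finset ι)
    (f : ι → ι → ℝ) :
    ∑ i ∈ s, ∑ j ∈ s.erase i, (f i i * f j j - f i j ^ 2)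
      = (∑ i ∈ s, f i i) ^ 2 - ∑ i ∈ s, ∑ j ∈ s, f i j ^ 2 := by
  have h : ∀ i ∈ s, ∑ j ∈ s.erase i, (f i i * f j j - f i j ^ 2)
      = ∑ j ∈ s, (f i i * f j j - f i j ^ 2) := fun i _ =>
    Finset.sum_erase s (by ring)
  rw [Finset.sum_congr rfl h, sq, Finset.sum_mul_sum]
  simp only [Finset.sum_sub_distrib]

/-- Young's inequality with weight `ε`, for the product of two traces. -/
theorem neg_two_mul_sum_diag_mul_sum_diag_le {ι : Type*} (s t : Finset ι) (f : ι → ι → ℝ)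
    {ε : ℝ} (hε : 0 < ε) :
    -2 * ((∑ i ∈ s, f i i) * ∑ i ∈ t, f i i)
      ≤ s.card * ε * (∑ i ∈ s, ∑ j ∈ s, f i j ^ 2)
        + t.card / ε * ∑ i ∈ t, ∑ j ∈ t, f i j ^ 2 := by
  have hs := mul_le_mul_of_nonneg_left (sq_sum_diag_le s f) hε.le
  have ht := mul_le_mul_of_nonneg_left (sq_sum_diag_le t f) (inv_pos.2 hε).le
  set S := ∑ i ∈ s, f i i
  set T := ∑ i ∈ t, f i i
  have hy : 0 ≤ ε * S ^ 2 + 2 * (S * T) + ε⁻¹ * T ^ 2 := by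
    have h : ε * S ^ 2 + 2 * (S * T) + ε⁻¹ * T ^ 2 = ε⁻¹ * (ε * S + T) ^ 2 := by
      field_simp
      ring
    rw [h]
    positivity
  rw [div_eq_mul_inv]
  linarith

/-- Lemma 3.5 (first step), inequality (3.20) of the paper: for every `ε > 0`,
`𝓕(II) ≤ (1/p) ((p+2) Σ_{i,α,μ} (b^μ_{iα})² + nε Σ_{i,j,μ} (b^μ_{ij})²
  + (n + p/ε) Σ_{α,β,μ} (b^μ_{αβ})²)`.
Indices: `i, j ∈ {1,…,n}`, `α, β ∈ {n+1,…,m}`, `μ ∈ {m+1,…,d}`. -/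
theorem stmt_0 (m n p d : ℕ) (hn : 1 ≤ n) (hnm : n ≤ m - 2) (hp : p = m - n) (hd : m ≤ d)
    (b : ℕ → ℕ → ℕ → ℝ)
    (hsym : ∀ μ ∈ Finset.Icc (m + 1) d, ∀ A ∈ Finset.Icc 1 m, ∀ B ∈ Finset.Icc 1 m,
      b μ A B = b μ B A)
    (ε : ℝ) (hε : 0 < ε) :
    (1 + 2 / (p : ℝ)) *
        (∑ μ ∈ Finset.Icc (m + 1) d, ∑ i ∈ Finset.Icc 1 n, ∑ α ∈ Finset.Icc (n + 1) m,
          (b μ i α) ^ 2)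
      - (2 / (p : ℝ)) *
        (∑ μ ∈ Finset.Icc (m + 1) d,
          (∑ i ∈ Finset.Icc 1 n, b μ i i) * (∑ α ∈ Finset.Icc (n + 1) m, b μ α α))
      + ((n : ℝ) / ((p : ℝ) * ((p : ℝ) - 1))) *
        (∑ μ ∈ Finset.Icc (m + 1) d, ∑ α ∈ Finset.Icc (n + 1) m,
          ∑ β ∈ (Finset.Icc (n + 1) m).erase α,
            (b μ α α * b μ β β - (b μ α β) ^ 2))
    ≤ (1 / (p : ℝ)) *
        ( ((p : ℝ) + 2) *
            (∑ μ ∈ Finset.Icc (m + 1) d, ∑ i ∈ Finset.Icc 1 n, ∑ α ∈ Finset.Icc (n + 1) m,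
              (b μ i α) ^ 2)
          + (n : ℝ) * ε *
            (∑ μ ∈ Finset.Icc (m + 1) d, ∑ i ∈ Finset.Icc 1 n, ∑ j ∈ Finset.Icc 1 n,
              (b μ i j) ^ 2)
          + ((n : ℝ) + (p : ℝ) / ε) *
            (∑ μ ∈ Finset.Icc (m + 1) d, ∑ α ∈ Finset.Icc (n + 1) m, ∑ β ∈ Finset.Icc (n + 1) m,
              (b μ α β) ^ 2) ) := by
  have hpR : (2 : ℝ) ≤ p := by
    have h : 2 ≤ p := by omega
    exact_mod_cast h
  have hp0 : (0 : ℝ) < p := by linarith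
  have hp1 : (0 : ℝ) < p - 1 := by linarith
  have hcn : (Finset.Icc 1 n).card = n := by simp
  have hcp : (Finset.Icc (n + 1) m).card = p := by
    rw [Nat.card_Icc]
    omega
  have hyoung := Finset.sum_le_sum fun μ (_ : μ ∈ Finset.Icc (m + 1) d) =>
    neg_two_mul_sum_diag_mul_sum_diag_le (Finset.Icc 1 n) (Finset.Icc (n + 1) m) (b μ) hε
  have hminor : ∑ μ ∈ Finset.Icc (m + 1) d, ∑ α ∈ Finset.Icc (n + 1) m,
      ∑ β ∈ (Finset.Icc (n + 1) m).erase α, (b μ α α * b μ β β - b μ α β ^ 2)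
      ≤ ∑ μ ∈ Finset.Icc (m + 1) d, ((p : ℝ) - 1) *
        ∑ α ∈ Finset.Icc (n + 1) m, ∑ β ∈ Finset.Icc (n + 1) m, b μ α β ^ 2 := by
    refine Finset.sum_le_sum fun μ _ => ?_
    have h := sq_sum_diag_le (Finset.Icc (n + 1) m) (b μ)
    rw [hcp] at h
    rw [sum_erase_diag_mul_diag_sub_sq]
    linarith
  rw [hcn, hcp, Finset.sum_add_distrib, ← Finset.mul_sum, ← Finset.mul_sum,
    ← Finset.mul_sum] at hyoung
  rw [← Finset.mul_sum] at hminor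
  have hyoung' := mul_le_mul_of_nonneg_left hyoung (one_div_pos.2 hp0).le
  have hminor' := mul_le_mul_of_nonneg_left hminor
    (div_nonneg (Nat.cast_nonneg n) (mul_pos hp0 hp1).le : (0 : ℝ) ≤ n / (p * (p - 1)))
  rw [← mul_assoc (_ / _) ((p : ℝ) - 1),
    show (n : ℝ) / (p * (p - 1)) * (p - 1) = 1 / p * n by field_simp] at hminor'
  rw [show 1 + 2 / (p : ℝ) = 1 / p * (p + 2) by field_simp,
    show 2 / (p : ℝ) = 1 / p * 2 by ring]
  linarith
end

section
/- Let ε₀ = (n + √(n² + 4np))/(2n) (the positive root of nε² − nε − p = 0), let c₂(m,n) = max{1 + p/2, nε₀}, and let c₁(m,n) = c₂(m,n)/p. Then F(b) ≤ c₁(m,n) · |b|². -/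
/-- A binary quadratic form with positive leading coefficient and nonpositive discriminant is
nonnegative, in the normalisation used below. -/
lemma quadratic_form_nonneg {n p c : ℝ} (hn : 0 < n) (hp : 0 < p) (hc : 0 < c)
    (hcn : n * p ≤ c * (c - n)) (H K : ℝ) :
    0 ≤ c * H ^ 2 / n + 2 * H * K + (c - n) / p * K ^ 2 := by
  have key : c * H ^ 2 / n + 2 * H * K + (c - n) / p * K ^ 2
      = (c * H + n * K) ^ 2 / (n * c) + K ^ 2 * (c * (c - n) - n * p) / (p * c) := by
    field_simp
    ring
  rw [key]
  have h : 0 ≤ c * (c - n) - n * p := by linarith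
  positivity

/-- The sum of `2 × 2` principal minors over ordered pairs of distinct indices. -/
lemma sum_erase_minors (J : Finset ℕ) (b : ℕ → ℕ → ℝ) :
    ∑ α ∈ J, ∑ β ∈ J.erase α, (b α α * b β β - b α β ^ 2)
      = (∑ α ∈ J, b α α) ^ 2 - ∑ α ∈ J, ∑ β ∈ J, b α β ^ 2 := by
  rw [sq, Finset.sum_mul_sum, ← Finset.sum_sub_distrib]
  refine Finset.sum_congr rfl fun α hα => ?_
  rw [← Finset.sum_sub_distrib, ← Finset.add_sum_erase J _ hα]
  ring

/-- The squared trace is at most the size of the block times its squared Frobenius norm. -/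
lemma sq_trace_le_card_mul (J : Finset ℕ) (b : ℕ → ℕ → ℝ) :
    (∑ α ∈ J, b α α) ^ 2 ≤ (J.card : ℝ) * ∑ α ∈ J, ∑ β ∈ J, b α β ^ 2 := by
  refine sq_sum_le_card_mul_sum_sq.trans (mul_le_mul_of_nonneg_left ?_ (Nat.cast_nonneg _))
  exact Finset.sum_le_sum fun α hα =>
    Finset.single_le_sum (f := fun β => b α β ^ 2) (fun β _ => sq_nonneg _) hα

/-- The estimate for a single symmetric matrix split into blocks indexed by `I` and `J`. -/
lemma block_estimate (I J : Finset ℕ) (hIJ : Disjoint I J) (b : ℕ → ℕ → ℝ)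
    (hsym : ∀ i ∈ I, ∀ α ∈ J, b α i = b i α) {n p c : ℝ} (hI : (I.card : ℝ) = n)
    (hJ : (J.card : ℝ) = p) (hn : 0 < n) (hp : 1 < p) (hc : 1 + p / 2 ≤ c)
    (hcn : n * p ≤ c * (c - n)) :
    (1 + 2 / p) * (∑ i ∈ I, ∑ α ∈ J, b i α ^ 2)
      - (2 / p) * ((∑ i ∈ I, b i i) * (∑ α ∈ J, b α α))
      + (n / (p * (p - 1))) * (∑ α ∈ J, ∑ β ∈ J.erase α, (b α α * b β β - b α β ^ 2))
    ≤ c / p * (∑ A ∈ I ∪ J, ∑ B ∈ I ∪ J, b A B ^ 2) := by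
  have hp0 : 0 < p := by linarith
  have hp1 : 0 < p - 1 := by linarith
  have hc0 : 0 < c := by linarith
  have hA := sq_trace_le_card_mul I b
  have hB := sq_trace_le_card_mul J b
  have hmix : ∑ α ∈ J, ∑ i ∈ I, b α i ^ 2 = ∑ i ∈ I, ∑ α ∈ J, b i α ^ 2 := by
    rw [Finset.sum_comm]
    exact Finset.sum_congr rfl fun i hi => Finset.sum_congr rfl fun α hα => by
      rw [hsym i hi α hα]
  rw [sum_erase_minors]
  simp only [Finset.sum_union hIJ, Finset.sum_add_distrib]
  rw [hmix]
  rw [hI] at hA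
  rw [hJ] at hB
  have hS : 0 ≤ ∑ i ∈ I, ∑ α ∈ J, b i α ^ 2 :=
    Finset.sum_nonneg fun _ _ => Finset.sum_nonneg fun _ _ => sq_nonneg _
  generalize ∑ i ∈ I, ∑ α ∈ J, b i α ^ 2 = S at *
  generalize ∑ i ∈ I, ∑ j ∈ I, b i j ^ 2 = A at *
  generalize ∑ i ∈ J, ∑ j ∈ J, b i j ^ 2 = B at *
  generalize ∑ i ∈ I, b i i = H at *
  generalize ∑ i ∈ J, b i i = K at *
  have hq := quadratic_form_nonneg hn hp0 hc0 hcn H K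
  have key : c / p * (A + S + (S + B))
      - ((1 + 2 / p) * S - 2 / p * (H * K) + n / (p * (p - 1)) * (K ^ 2 - B))
      = (2 * (c - (1 + p / 2)) * S + c / n * (n * A - H ^ 2)
        + (c + n / (p - 1)) / p * (p * B - K ^ 2)
        + (c * H ^ 2 / n + 2 * H * K + (c - n) / p * K ^ 2)) / p := by
    field_simp
    ring
  have h₁ : 0 ≤ c - (1 + p / 2) := by linarith
  have h₂ : 0 ≤ n * A - H ^ 2 := by linarith
  have h₃ : 0 ≤ p * B - K ^ 2 := by linarith
  rw [← sub_nonneg, key]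
  positivity


/-- Lemma 3.5 of the paper: with `ε₀` the positive root of `nε² − nε − p = 0`,
`c₂(m,n) = max {1 + p/2, n ε₀}` and `c₁(m,n) = c₂(m,n)/p`, one has
`𝓕(II) ≤ c₁(m,n) |II|²`. -/
theorem stmt_1 (m n p d : ℕ) (hn : 1 ≤ n) (hnm : n ≤ m - 2) (hp : p = m - n) (hd : m ≤ d)
    (b : ℕ → ℕ → ℕ → ℝ)
    (hsym : ∀ μ ∈ Finset.Icc (m + 1) d, ∀ A ∈ Finset.Icc 1 m, ∀ B ∈ Finset.Icc 1 m,
      b μ A B = b μ B A)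
    (ε₀ c₁ c₂ : ℝ)
    (hε₀ : ε₀ = ((n : ℝ) + Real.sqrt ((n : ℝ) ^ 2 + 4 * (n : ℝ) * (p : ℝ))) / (2 * (n : ℝ)))
    (hc₂ : c₂ = max (1 + (p : ℝ) / 2) ((n : ℝ) * ε₀))
    (hc₁ : c₁ = c₂ / (p : ℝ)) :
    (1 + 2 / (p : ℝ)) *
        (∑ μ ∈ Finset.Icc (m + 1) d, ∑ i ∈ Finset.Icc 1 n, ∑ α ∈ Finset.Icc (n + 1) m,
          (b μ i α) ^ 2)
      - (2 / (p : ℝ)) *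
        (∑ μ ∈ Finset.Icc (m + 1) d,
          (∑ i ∈ Finset.Icc 1 n, b μ i i) * (∑ α ∈ Finset.Icc (n + 1) m, b μ α α))
      + ((n : ℝ) / ((p : ℝ) * ((p : ℝ) - 1))) *
        (∑ μ ∈ Finset.Icc (m + 1) d, ∑ α ∈ Finset.Icc (n + 1) m,
          ∑ β ∈ (Finset.Icc (n + 1) m).erase α,
            (b μ α α * b μ β β - (b μ α β) ^ 2))
    ≤ c₁ * (∑ μ ∈ Finset.Icc (m + 1) d, ∑ A ∈ Finset.Icc 1 m, ∑ B ∈ Finset.Icc 1 m,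
          (b μ A B) ^ 2) := by
  have hp2 : 2 ≤ p := by omega
  have hnR : (0 : ℝ) < n := by exact_mod_cast hn
  have hpR : (2 : ℝ) ≤ p := by exact_mod_cast hp2
  have hcn : (n : ℝ) * p ≤ c₂ * (c₂ - n) := by
    have hs := Real.sq_sqrt (show 0 ≤ (n : ℝ) ^ 2 + 4 * n * p by positivity)
    have hs0 := Real.sqrt_nonneg ((n : ℝ) ^ 2 + 4 * n * p)
    have hx : (n : ℝ) * ε₀ = (n + Real.sqrt ((n : ℝ) ^ 2 + 4 * n * p)) / 2 := by
      rw [hε₀]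
      field_simp
    have hle : (n : ℝ) * ε₀ ≤ c₂ := hc₂ ▸ le_max_right _ _
    rw [hx] at hle
    nlinarith
  have hunion : Finset.Icc 1 m = Finset.Icc 1 n ∪ Finset.Icc (n + 1) m := by
    ext a
    simp only [Finset.mem_union, Finset.mem_Icc]
    omega
  have hdisj : Disjoint (Finset.Icc 1 n) (Finset.Icc (n + 1) m) := by
    rw [Finset.disjoint_left]
    intro a
    simp only [Finset.mem_Icc]
    omega
  have hJ : ((Finset.Icc (n + 1) m).card : ℝ) = p := by
    rw [Nat.card_Icc, hp]
    congr 1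
    omega
  simp only [Finset.mul_sum (Finset.Icc (m + 1) d)]
  rw [← Finset.sum_sub_distrib, ← Finset.sum_add_distrib]
  refine Finset.sum_le_sum fun μ hμ => ?_
  rw [hc₁, hunion]
  refine block_estimate _ _ hdisj (b μ) (fun i hi α hα => ?_) (by simp) hJ hnR (by linarith)
    (hc₂ ▸ le_max_left _ _) hcn
  exact hsym μ hμ α (hunion ▸ Finset.mem_union_right _ hα) i
    (hunion ▸ Finset.mem_union_left _ hi)
end

section
/- If n = 1 (so p = m − 1 and m ≥ 3), then F(b) ≤ ((m+1)/(2(m−1))) · |b|². -/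
/-- Scalar inequality behind the trace estimate: `x` is the distinguished diagonal entry, `S` and
`Q` the sum and the sum of squares of the other `p` diagonal entries. -/
lemma trace_scalar_bound {p x S Q R O : ℝ} (hp : 2 ≤ p) (hO : 0 ≤ O) (hS : S ^ 2 ≤ p * Q) :
    (1 + 2 / p) * R - 2 / p * (x * S) + 1 / (p * (p - 1)) * (S ^ 2 - Q - O) ≤
      (p + 2) / (2 * p) * (x ^ 2 + 2 * R + Q + O) := by
  have hp0 : 0 < p := by linarith
  have hp1 : 0 < p - 1 := by linarith
  have key : 0 ≤ (p - 1) * ((p - 2) * x ^ 2 + (2 * x + S) ^ 2)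
      + (p + 1) * (p * Q - S ^ 2) + ((p + 2) * (p - 1) + 2) * O := by
    have h1 : 0 ≤ (p - 2) * x ^ 2 := mul_nonneg (by linarith) (sq_nonneg x)
    have h2 : 0 ≤ (p - 1) * ((p - 2) * x ^ 2 + (2 * x + S) ^ 2) :=
      mul_nonneg hp1.le (add_nonneg h1 (sq_nonneg _))
    have h3 : 0 ≤ (p + 1) * (p * Q - S ^ 2) := mul_nonneg (by linarith) (by linarith)
    have h4 : 0 ≤ ((p + 2) * (p - 1) + 2) * O := mul_nonneg (by nlinarith) hO
    linarith
  rw [← sub_nonneg]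
  have hne := hp1.ne'
  have : (p + 2) / (2 * p) * (x ^ 2 + 2 * R + Q + O)
      - ((1 + 2 / p) * R - 2 / p * (x * S) + 1 / (p * (p - 1)) * (S ^ 2 - Q - O))
      = ((p - 1) * ((p - 2) * x ^ 2 + (2 * x + S) ^ 2)
      + (p + 1) * (p * Q - S ^ 2) + ((p + 2) * (p - 1) + 2) * O) / (2 * p * (p - 1)) := by
    field_simp
    ring
  rw [this]
  positivity

/-- The quadratic form estimate for one matrix `c` indexed by `insert a s`, symmetric in the row
and column of `a`. -/
lemma quadratic_form_bound {ι : Type*} [DecidableEq ι] (s : Finset ι) (a : ι) (ha : a ∉ s)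
    (hs : 2 ≤ s.card) (c : ι → ι → ℝ) (hc : ∀ α ∈ s, c α a = c a α) :
    (1 + 2 / (s.card : ℝ)) * ∑ α ∈ s, c a α ^ 2 - 2 / (s.card : ℝ) * (c a a * ∑ α ∈ s, c α α)
      + 1 / ((s.card : ℝ) * ((s.card : ℝ) - 1)) *
        ∑ α ∈ s, ∑ β ∈ s.erase α, (c α α * c β β - c α β ^ 2) ≤
      ((s.card : ℝ) + 2) / (2 * (s.card : ℝ)) *
        ∑ A ∈ insert a s, ∑ B ∈ insert a s, c A B ^ 2 := by
  have hcol : ∑ α ∈ s, c α a ^ 2 = ∑ α ∈ s, c a α ^ 2 :=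
    Finset.sum_congr rfl fun α hα => by rw [hc α hα]
  have hsq : ∑ α ∈ s, ∑ β ∈ s, c α β ^ 2
      = ∑ α ∈ s, c α α ^ 2 + ∑ α ∈ s, ∑ β ∈ s.erase α, c α β ^ 2 := by
    rw [← Finset.sum_add_distrib]
    exact Finset.sum_congr rfl fun α hα => (Finset.add_sum_erase s (fun β => c α β ^ 2) hα).symm
  have hprod : ∑ α ∈ s, ∑ β ∈ s.erase α, (c α α * c β β - c α β ^ 2)
      = (∑ α ∈ s, c α α) ^ 2 - ∑ α ∈ s, c α α ^ 2
        - ∑ α ∈ s, ∑ β ∈ s.erase α, c α β ^ 2 := by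
    rw [sq, Finset.sum_mul_sum, ← Finset.sum_sub_distrib, ← Finset.sum_sub_distrib]
    refine Finset.sum_congr rfl fun α hα => ?_
    rw [Finset.sum_sub_distrib, ← Finset.add_sum_erase s (fun β => c α α * c β β) hα]
    ring
  have htot : ∑ A ∈ insert a s, ∑ B ∈ insert a s, c A B ^ 2
      = c a a ^ 2 + 2 * ∑ α ∈ s, c a α ^ 2 + ∑ α ∈ s, c α α ^ 2
        + ∑ α ∈ s, ∑ β ∈ s.erase α, c α β ^ 2 := by
    simp only [Finset.sum_insert ha, Finset.sum_add_distrib, hcol, hsq]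
    ring
  rw [hprod, htot]
  exact trace_scalar_bound (by exact_mod_cast hs)
    (Finset.sum_nonneg fun _ _ => Finset.sum_nonneg fun _ _ => sq_nonneg _)
    sq_sum_le_card_mul_sum_sq


/-- Remark 3.6 of the paper, case `n = 1` (taking `ε = 2`):
`𝓕(II) ≤ ((m+1)/(2(m−1))) |II|²`. -/
theorem stmt_2 (m n p d : ℕ) (hn : 1 ≤ n) (hnm : n ≤ m - 2) (hp : p = m - n) (hd : m ≤ d)
    (b : ℕ → ℕ → ℕ → ℝ)
    (hsym : ∀ μ ∈ Finset.Icc (m + 1) d, ∀ A ∈ Finset.Icc 1 m, ∀ B ∈ Finset.Icc 1 m,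
      b μ A B = b μ B A)
    (hn1 : n = 1) :
    (1 + 2 / (p : ℝ)) *
        (∑ μ ∈ Finset.Icc (m + 1) d, ∑ i ∈ Finset.Icc 1 n, ∑ α ∈ Finset.Icc (n + 1) m,
          (b μ i α) ^ 2)
      - (2 / (p : ℝ)) *
        (∑ μ ∈ Finset.Icc (m + 1) d,
          (∑ i ∈ Finset.Icc 1 n, b μ i i) * (∑ α ∈ Finset.Icc (n + 1) m, b μ α α))
      + ((n : ℝ) / ((p : ℝ) * ((p : ℝ) - 1))) *
        (∑ μ ∈ Finset.Icc (m + 1) d, ∑ α ∈ Finset.Icc (n + 1) m,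
          ∑ β ∈ (Finset.Icc (n + 1) m).erase α,
            (b μ α α * b μ β β - (b μ α β) ^ 2))
    ≤ (((m : ℝ) + 1) / (2 * ((m : ℝ) - 1))) * (∑ μ ∈ Finset.Icc (m + 1) d, ∑ A ∈ Finset.Icc 1 m, ∑ B ∈ Finset.Icc 1 m,
          (b μ A B) ^ 2) := by
  subst hn1
  have hm : 3 ≤ m := by omega
  have hcard : (Finset.Icc (1 + 1) m).card = p := by rw [Nat.card_Icc]; omega
  have hIcc : Finset.Icc 1 m = insert 1 (Finset.Icc (1 + 1) m) := by
    ext x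
    simp only [Finset.mem_insert, Finset.mem_Icc]
    omega
  have hmp : (m : ℝ) = p + 1 := by
    have : m = p + 1 := by omega
    exact_mod_cast this
  have hcoef : ((m : ℝ) + 1) / (2 * ((m : ℝ) - 1)) = ((p : ℝ) + 2) / (2 * (p : ℝ)) := by
    rw [hmp]
    ring_nf
  rw [hcoef]
  simp only [Finset.mul_sum (Finset.Icc (m + 1) d)]
  rw [← Finset.sum_sub_distrib, ← Finset.sum_add_distrib]
  refine Finset.sum_le_sum fun μ hμ => ?_
  have h := quadratic_form_bound (Finset.Icc (1 + 1) m) 1 (by simp) (by omega) (b μ)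
    fun α hα => hsym μ hμ α (hIcc ▸ Finset.mem_insert_of_mem hα) 1
      (hIcc ▸ Finset.mem_insert_self _ _)
  rw [hcard, ← hIcc] at h
  simpa only [Finset.Icc_self, Finset.sum_singleton, Nat.cast_one] using h
end

section
/- If 2 ≤ n ≤ m − 2, then F(b) ≤ (m/(m−n)) · |b|². -/
open Finset in
/-- The square of a trace is bounded by the dimension times the squared Frobenius norm. -/
theorem sq_trace_le_card_mul_sum_sq {ι : Type*} (s : Finset ι) (a : ι → ι → ℝ) :
    (∑ i ∈ s, a i i) ^ 2 ≤ (#s : ℝ) * ∑ i ∈ s, ∑ j ∈ s, (a i j) ^ 2 := by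
  refine sq_sum_le_card_mul_sum_sq.trans ?_
  gcongr with i hi
  exact single_le_sum (f := fun j => (a i j) ^ 2) (fun j _ => sq_nonneg _) hi

open Finset in
/-- The sum of the off-diagonal `2 × 2` principal minors of a matrix equals the square of its trace
minus its squared Frobenius norm. -/
theorem sum_erase_minors_eq {ι : Type*} [DecidableEq ι] (s : Finset ι) (a : ι → ι → ℝ) :
    ∑ i ∈ s, ∑ j ∈ s.erase i, (a i i * a j j - (a i j) ^ 2)
      = (∑ i ∈ s, a i i) ^ 2 - ∑ i ∈ s, ∑ j ∈ s, (a i j) ^ 2 := by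
  rw [sq (∑ i ∈ s, a i i), sum_mul_sum, ← sum_sub_distrib]
  refine sum_congr rfl fun i hi => ?_
  rw [← sum_sub_distrib, ← add_sum_erase s _ hi]
  ring

open Finset in
/-- The squared Frobenius norm of a symmetric matrix, split into blocks. -/
theorem sum_sq_union_of_symm {ι : Type*} [DecidableEq ι] {s t : Finset ι} (hst : Disjoint s t)
    (a : ι → ι → ℝ) (hsym : ∀ i ∈ s, ∀ j ∈ t, a i j = a j i) :
    ∑ i ∈ s ∪ t, ∑ j ∈ s ∪ t, (a i j) ^ 2
      = ∑ i ∈ s, ∑ j ∈ s, (a i j) ^ 2 + 2 * ∑ i ∈ s, ∑ j ∈ t, (a i j) ^ 2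
        + ∑ i ∈ t, ∑ j ∈ t, (a i j) ^ 2 := by
  have hX : ∑ i ∈ t, ∑ j ∈ s, (a i j) ^ 2 = ∑ i ∈ s, ∑ j ∈ t, (a i j) ^ 2 := by
    rw [sum_comm]
    exact sum_congr rfl fun i hi => sum_congr rfl fun j hj => by rw [hsym i hi j hj]
  simp only [sum_union hst, sum_add_distrib, hX]
  ring

/-- The inequality for one normal direction, in terms of the traces `T`, `S` and the squared norms
`I`, `X`, `Q` of the blocks of the second fundamental form. -/
theorem block_inequality {n p T S I X Q : ℝ} (hn : 2 ≤ n) (hp : 2 ≤ p) (hX : 0 ≤ X) (hI : 0 ≤ I)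
    (hT : T ^ 2 ≤ n * I) (hS : S ^ 2 ≤ p * Q) :
    (1 + 2 / p) * X - 2 / p * (T * S) + n / (p * (p - 1)) * (S ^ 2 - Q)
      ≤ (n + p) / p * (I + 2 * X + Q) := by
  have hp0 : 0 < p := by linarith
  have hp1 : 0 < p - 1 := by linarith
  have hminor : n / (p * (p - 1)) * (S ^ 2 - Q) ≤ n / p * Q := by
    calc n / (p * (p - 1)) * (S ^ 2 - Q) ≤ n / (p * (p - 1)) * ((p - 1) * Q) := by
          gcongr
          linarith
      _ = n / p * Q := by field_simp
  have hmain : (p + 2) * X - 2 * (T * S) + n * Q ≤ (n + p) * (I + 2 * X + Q) := by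
    nlinarith [sq_nonneg (T + S), mul_nonneg hp0.le hI, mul_nonneg hp0.le hX,
      mul_nonneg (sub_nonneg.2 hn) hX]
  calc (1 + 2 / p) * X - 2 / p * (T * S) + n / (p * (p - 1)) * (S ^ 2 - Q)
      ≤ (1 + 2 / p) * X - 2 / p * (T * S) + n / p * Q := by gcongr
    _ = ((p + 2) * X - 2 * (T * S) + n * Q) / p := by field_simp
    _ ≤ (n + p) * (I + 2 * X + Q) / p := by gcongr
    _ = (n + p) / p * (I + 2 * X + Q) := by ring

/-- Remark 3.6 of the paper, case `2 ≤ n ≤ m − 2` (taking `ε = 1`):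
`𝓕(II) ≤ (m/(m−n)) |II|²`. -/
theorem stmt_3 (m n p d : ℕ) (hn : 2 ≤ n) (hnm : n ≤ m - 2) (hp : p = m - n) (hd : m ≤ d)
    (b : ℕ → ℕ → ℕ → ℝ)
    (hsym : ∀ μ ∈ Finset.Icc (m + 1) d, ∀ A ∈ Finset.Icc 1 m, ∀ B ∈ Finset.Icc 1 m,
      b μ A B = b μ B A) :
    (1 + 2 / (p : ℝ)) *
        (∑ μ ∈ Finset.Icc (m + 1) d, ∑ i ∈ Finset.Icc 1 n, ∑ α ∈ Finset.Icc (n + 1) m,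
          (b μ i α) ^ 2)
      - (2 / (p : ℝ)) *
        (∑ μ ∈ Finset.Icc (m + 1) d,
          (∑ i ∈ Finset.Icc 1 n, b μ i i) * (∑ α ∈ Finset.Icc (n + 1) m, b μ α α))
      + ((n : ℝ) / ((p : ℝ) * ((p : ℝ) - 1))) *
        (∑ μ ∈ Finset.Icc (m + 1) d, ∑ α ∈ Finset.Icc (n + 1) m,
          ∑ β ∈ (Finset.Icc (n + 1) m).erase α,
            (b μ α α * b μ β β - (b μ α β) ^ 2))
    ≤ ((m : ℝ) / ((m : ℝ) - (n : ℝ))) * (∑ μ ∈ Finset.Icc (m + 1) d, ∑ A ∈ Finset.Icc 1 m, ∑ B ∈ Finset.Icc 1 m,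
          (b μ A B) ^ 2) := by
  have hm : m = n + p := by omega
  have hp2 : (2 : ℝ) ≤ p := by exact_mod_cast (by omega : 2 ≤ p)
  have hn2 : (2 : ℝ) ≤ n := by exact_mod_cast hn
  have hdisj : Disjoint (Finset.Icc 1 n) (Finset.Icc (n + 1) m) := by
    rw [Finset.disjoint_left]
    intro x hx hx'
    rw [Finset.mem_Icc] at hx hx'
    omega
  have hunion : Finset.Icc 1 m = Finset.Icc 1 n ∪ Finset.Icc (n + 1) m := by
    ext x
    simp only [Finset.mem_union, Finset.mem_Icc]
    omega
  have hcoef : (m : ℝ) / ((m : ℝ) - n) = ((n : ℝ) + p) / p := by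
    rw [hm]
    push_cast
    rw [add_sub_cancel_left]
  rw [hcoef]
  simp only [Finset.mul_sum (Finset.Icc (m + 1) d)]
  rw [← Finset.sum_sub_distrib, ← Finset.sum_add_distrib]
  refine Finset.sum_le_sum fun μ hμ => ?_
  have hsymμ : ∀ i ∈ Finset.Icc 1 n, ∀ j ∈ Finset.Icc (n + 1) m, b μ i j = b μ j i :=
    fun i hi j hj => hsym μ hμ i (hunion ▸ Finset.mem_union_left _ hi) j
      (hunion ▸ Finset.mem_union_right _ hj)
  rw [sum_erase_minors_eq, hunion, sum_sq_union_of_symm hdisj (b μ) hsymμ]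
  have hT := sq_trace_le_card_mul_sum_sq (Finset.Icc 1 n) (b μ)
  have hS := sq_trace_le_card_mul_sum_sq (Finset.Icc (n + 1) m) (b μ)
  rw [Nat.card_Icc, show n + 1 - 1 = n by omega] at hT
  rw [Nat.card_Icc, show m + 1 - (n + 1) = p by omega] at hS
  exact block_inequality hn2 hp2 (by positivity) (by positivity) hT hS
end

section
/- Σ_{i,j,k,l=1}^n g^{ik} g^{jl} h_{ij} h_{kl} = (1/(w² F²)) ( n a⁴ + ((1 − a²)/w²)² |v|⁴ + 2 a² ((1 − a²)/w²) |v|² ). -/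
/-- The product of two matrices of the form `p δ + q v vᵀ` is again of this form. -/
theorem sum_scalar_add_rankOne_mul {n : ℕ} (v : Fin n → ℝ) (p q r t : ℝ) (i l : Fin n) :
    ∑ k, (p * (if i = k then (1 : ℝ) else 0) + q * (v i * v k)) *
        (r * (if k = l then (1 : ℝ) else 0) + t * (v k * v l))
      = p * r * (if i = l then (1 : ℝ) else 0)
        + (p * t + q * r + q * t * ∑ k, v k ^ 2) * (v i * v l) := by
  have expand : ∀ k, (p * (if i = k then (1 : ℝ) else 0) + q * (v i * v k)) *
        (r * (if k = l then (1 : ℝ) else 0) + t * (v k * v l))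
      = (if i = k then p * r * (if k = l then (1 : ℝ) else 0) + p * t * (v k * v l) else 0)
        + (if k = l then q * r * (v i * v k) else 0) + q * t * (v i * v l) * v k ^ 2 := by
    intro k
    split_ifs <;> ring
  simp only [expand, Finset.sum_add_distrib, ← Finset.mul_sum, Finset.sum_ite_eq,
    Finset.sum_ite_eq', Finset.mem_univ, if_true]
  ring

/-- The trace of `p δ + q v vᵀ`. -/
theorem sum_diag_scalar_add_rankOne {n : ℕ} (v : Fin n → ℝ) (p q : ℝ) :
    ∑ i, (p + q * (v i * v i))
      = n * p + q * ∑ k, v k ^ 2 := by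
  simp [Finset.sum_add_distrib, ← Finset.mul_sum, pow_two]

/-- For symmetric `g` and `h`, the full contraction of `h` with itself by `g` is the trace
of the square of `g h`. -/
theorem sum_contraction_eq_trace_sq {n : ℕ} (g h : Fin n → Fin n → ℝ)
    (hg : ∀ i j, g i j = g j i) (hh : ∀ i j, h i j = h j i) :
    ∑ i, ∑ j, ∑ k, ∑ l, g i k * g j l * h i j * h k l
      = ∑ i, ∑ l, (∑ k, g i k * h k l) * ∑ j, g l j * h j i := by
  refine Finset.sum_congr rfl fun i _ => ?_
  simp only [Finset.sum_mul_sum]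
  rw [Finset.sum_comm]
  conv_rhs => rw [Finset.sum_comm]
  refine Finset.sum_congr rfl fun k _ => ?_
  rw [Finset.sum_comm]
  refine Finset.sum_congr rfl fun l _ => Finset.sum_congr rfl fun j _ => ?_
  rw [hg l j, hh j i]
  ring


/-- Appendix A of the paper: the squared norm `|h|²_g = Σ_{i,j,k,l} g^{ik} g^{jl} h_{ij} h_{kl}`
of the second fundamental form of the graph of the ellipsoid satisfies
`|h|²_g = (1/(w²F²)) (n a⁴ + ((1 − a²)/w²)² |v|⁴ + 2 a² ((1 − a²)/w²) |v|²)`,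
where `g^{ij} = δ_{ij} − v_i v_j / w²`, `h_{ij} = (a² δ_{ij} + v_i v_j)/(wF)` and
`w = √(1 + |v|²)`. -/
theorem stmt_10 (n : ℕ) (hn : 1 ≤ n) (a F w : ℝ) (ha : 0 < a) (hF : 0 < F)
    (v : Fin n → ℝ) (hw : w = Real.sqrt (1 + ∑ k : Fin n, v k ^ 2))
    (g h : Fin n → Fin n → ℝ)
    (hg : ∀ i j, g i j = (if i = j then (1 : ℝ) else 0) - v i * v j / w ^ 2)
    (hh : ∀ i j, h i j = (a ^ 2 * (if i = j then (1 : ℝ) else 0) + v i * v j) / (w * F)) :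
    ∑ i : Fin n, ∑ j : Fin n, ∑ k : Fin n, ∑ l : Fin n, g i k * g j l * h i j * h k l
      = (1 / (w ^ 2 * F ^ 2)) *
          ((n : ℝ) * a ^ 4
            + ((1 - a ^ 2) / w ^ 2) ^ 2 * (∑ k : Fin n, v k ^ 2) ^ 2
            + 2 * a ^ 2 * ((1 - a ^ 2) / w ^ 2) * (∑ k : Fin n, v k ^ 2)) := by
  set s := ∑ k : Fin n, v k ^ 2 with hs
  have s_nonneg : 0 ≤ s := Finset.sum_nonneg fun k _ => sq_nonneg (v k)
  have w_sq : w ^ 2 = 1 + s := by rw [hw, Real.sq_sqrt (by linarith)]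
  have w_ne : w ≠ 0 := by
    rw [hw]
    exact (Real.sqrt_pos.mpr (by linarith)).ne'
  have F_ne : F ≠ 0 := hF.ne'
  have g_eq : ∀ i j, g i j = 1 * (if i = j then (1 : ℝ) else 0) + -(1 / w ^ 2) * (v i * v j) := by
    intro i j
    rw [hg]
    ring
  have h_eq : ∀ i j, h i j = a ^ 2 / (w * F) * (if i = j then (1 : ℝ) else 0)
      + 1 / (w * F) * (v i * v j) := by
    intro i j
    rw [hh]
    ring
  have coeff : 1 * (1 / (w * F)) + -(1 / w ^ 2) * (a ^ 2 / (w * F))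
      + -(1 / w ^ 2) * (1 / (w * F)) * s = (1 - a ^ 2) / w ^ 2 / (w * F) := by
    have s_eq : s = w ^ 2 - 1 := by linarith
    rw [s_eq]
    field_simp
    ring
  rw [sum_contraction_eq_trace_sq g h
    (fun i j => by rw [hg, hg, mul_comm (v i)]; simp only [eq_comm])
    (fun i j => by rw [hh, hh, mul_comm (v i)]; simp only [eq_comm])]
  simp only [g_eq, h_eq, sum_scalar_add_rankOne_mul, ← hs, coeff,
    if_true, mul_one]
  rw [sum_diag_scalar_add_rankOne, ← hs]
  field_simp
  ring
end
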